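/- Let D ⊆ ℝ^{p+2} be a domain invariant under (𝐱_p, r) ↦ (𝐱_p, −r) and let Ω = Ω_D be its p-symmetric completion. (i) If Ω ∩ ℝ^{p+1} = ∅ then 𝒢𝒮ℛ(Ω_D) is strictly contained in 𝒢𝒮ℳ(Ω). (ii) If Ω ∩ ℝ^{p+1} ≠ ∅ then 𝒢𝒮ℳ(Ω) = 𝒢𝒮ℛ(Ω_D). -/

import Mathlib

/-!
Common framework for generalized partial-slice monogenic functions
(Xu–Sabadini, "On the Fueter-Sce theorem for generalized partial-slice
monogenic functions").

The real Clifford algebra `ℝ_{p+q}` is formalized as the Mathlib Clifford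
algebra of the negative-definite quadratic form on `ℝ^{p+q}`; since Mathlib
provides no canonical norm on it, all analytic statements are phrased for an
arbitrary normed real algebra `A` together with an `ℝ`-algebra isomorphism
`ξ : A ≃ₐ[ℝ] Cl (p+q)`.  A point of `ℝ^{p+q+1}` is a pair
`(𝐱_p, 𝐱_q) : (Fin (p+1) → ℝ) × EuclideanSpace ℝ (Fin q)`, and a point of a
slice `ℝ^{p+2}` is a pair `(𝐱_p, r)`.
-/

noncomputable section

open Filter Topology MeasureTheory Metric
open scoped Nat RealInnerProductSpace

namespace GPS

/-- The negative definite quadratic form `-(x₁² + ⋯ + xₙ²)` on `ℝⁿ`. -/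
def Qe (n : ℕ) : QuadraticForm ℝ (Fin n → ℝ) :=
  QuadraticMap.weightedSumSquares ℝ (fun _ : Fin n => (-1 : ℝ))

/-- The real Clifford algebra `ℝ_n`. -/
abbrev Cl (n : ℕ) : Type := CliffordAlgebra (Qe n)

/-- The generators `e_1, …, e_n` of `ℝ_n` (indexed by `Fin n`). -/
def e (n : ℕ) (i : Fin n) : Cl n := CliffordAlgebra.ι (Qe n) (Pi.single i 1)

variable (p q : ℕ)

/-- `ℝ^{p+1}`, the "slice-axis" space. -/
abbrev Vp : Type := Fin (p + 1) → ℝ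

/-- `ℝ^q`. -/
abbrev Vq : Type := EuclideanSpace ℝ (Fin q)

/-- `ℝ^{p+q+1} = ℝ^{p+1} ⊕ ℝ^q`. -/
abbrev V : Type := Vp p × Vq q

/-- `ℝ^{p+2}`, the parameter space `(𝐱_p, r)` of a slice. -/
abbrev Sl : Type := Vp p × ℝ

/-- The sphere `𝕊` of unit 1-vectors, described by their coordinate vectors
`(x_{p+1}, …, x_{p+q}) ∈ ℝ^q` with `∑ x_i² = 1`. -/
def S : Set (Vq q) := {v | ∑ j, v j ^ 2 = 1}

/-- The point `𝐱_p + r ω` of `ℝ^{p+q+1}`. -/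
def spt (v : Vq q) (z : Sl p) : V p q := (z.1, z.2 • v)

/-- The (parameterized) slice `Ω_ω` of a set `Ω ⊆ ℝ^{p+q+1}`. -/
def sliceSet (Ω : Set (V p q)) (v : Vq q) : Set (Sl p) := {z | spt p q v z ∈ Ω}

/-- `Ω₀* = {𝐱_p + 𝐱_q : 𝐱_p ∈ Ω₀, 𝐱_q ∈ ℝ^q}`. -/
def star0 (Ω₀ : Set (Vp p)) : Set (V p q) := {z | z.1 ∈ Ω₀}

/-- The p-symmetric completion `Ω_D` of a set `D ⊆ ℝ^{p+2}`. -/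
def completion (D : Set (Sl p)) : Set (V p q) :=
  {x | ∃ z ∈ D, ∃ v ∈ S q, x = spt p q v z}

/-- `D` is invariant under the reflection of the `(p+2)`-th variable. -/
def ReflInv (D : Set (Sl p)) : Prop := ∀ z ∈ D, ((z.1, -z.2) : Sl p) ∈ D

/-- A domain: a nonempty open connected set. -/
def IsDomain {E : Type*} [TopologicalSpace E] (s : Set E) : Prop :=
  IsOpen s ∧ IsConnected s

/-- A slice domain. -/
def IsSliceDomain (Ω : Set (V p q)) : Prop :=
  IsDomain Ω ∧ (∃ x : Vp p, ((x, 0) : V p q) ∈ Ω) ∧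
    ∀ v ∈ S q, IsDomain (sliceSet p q Ω v)

/-- Partial symmetry with respect to `ℝ^{p+1}`. -/
def IsPSymmetric (Ω : Set (V p q)) : Prop :=
  ∀ (x : Vp p) (r : ℝ), ∀ v ∈ S q, ∀ w ∈ S q,
    ((x, r • v) : V p q) ∈ Ω → ((x, r • w) : V p q) ∈ Ω

/-- A `d`-dimensional smooth submanifold of a real normed space. -/
def IsSmoothSubmanifoldDim {E : Type*} [NormedAddCommGroup E] [NormedSpace ℝ E]
    (d : ℕ) (M : Set E) : Prop :=
  ∀ x ∈ M, ∃ U : Set E, IsOpen U ∧ x ∈ U ∧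
    ∃ (ψ : (Fin d → ℝ) → E) (W : Set (Fin d → ℝ)), IsOpen W ∧
      ContDiffOn ℝ (⊤ : ℕ∞) ψ W ∧ Set.InjOn ψ W ∧
      (∀ y ∈ W, Function.Injective (fderivWithin ℝ ψ W y)) ∧
      M ∩ U = ψ '' W

variable {A : Type*} [NormedRing A] [NormedAlgebra ℝ A] (ξ : A ≃ₐ[ℝ] Cl (p + q))

/-- The generators `e_1, …, e_{p+q}` inside `A`. -/
def gen (i : Fin (p + q)) : A := ξ.symm (e (p + q) i)

/-- The generators `e_{p+1}, …, e_{p+q}` (the "q-part"). -/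
def eQ (j : Fin q) : A := gen p q ξ ⟨p + (j : ℕ), by have := j.isLt; omega⟩

/-- The generators `e_1, …, e_p` (the "p-part", without `e_0 = 1`). -/
def eP (i : Fin p) : A := gen p q ξ ⟨(i : ℕ), by have := i.isLt; omega⟩

/-- `e_0 = 1, e_1, …, e_p`: the paravector basis of `ℝ^{p+1}` inside `A`. -/
def εp (i : Fin (p + 1)) : A :=
  if h : (i : ℕ) = 0 then 1 else gen p q ξ ⟨(i : ℕ) - 1, by have := i.isLt; omega⟩

/-- The 1-vector `∑ x_i e_{p+i} ∈ A` corresponding to `𝐱_q ∈ ℝ^q`;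
for a unit `v` this is the imaginary unit `ω ∈ 𝕊`. -/
def ωCl (v : Vq q) : A := ∑ j, v j • eQ p q ξ j

/-- The paravector `x_0 + x_1 e_1 + ⋯ + x_p e_p ∈ A` of `𝐱_p ∈ ℝ^{p+1}`. -/
def clP (x : Vp p) : A := ∑ i, x i • εp p q ξ i

/-- The paravector of `𝐱 ∈ ℝ^{p+q+1}` in `A`. -/
def toCl (z : V p q) : A := clP p q ξ z.1 + ωCl p q ξ z.2

section SliceOperators

variable {F' : Type*} [NormedAddCommGroup F'] [NormedSpace ℝ F']

/-- `∂_{x_i}` on functions on `ℝ^{p+2}`. -/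
def pdSl (i : Fin (p + 1)) (F : Sl p → F') : Sl p → F' :=
  fun z => fderiv ℝ F z (Pi.single i 1, 0)

/-- `∂_r` on functions on `ℝ^{p+2}`. -/
def pdr (F : Sl p → F') : Sl p → F' := fun z => fderiv ℝ F z (0, 1)

/-- `∂_{x_i}` (first factor) on functions on `ℝ^{p+q+1}`. -/
def pdV1 (i : Fin (p + 1)) (f : V p q → F') : V p q → F' :=
  fun z => fderiv ℝ f z ((Pi.single i 1 : Vp p), 0)

/-- `∂_{x_{p+j}}` (second factor) on functions on `ℝ^{p+q+1}`. -/
def pdV2 (j : Fin q) (f : V p q → F') : V p q → F' :=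
  fun z => fderiv ℝ f z (0, EuclideanSpace.single j 1)

/-- `∂_{x_i}` on functions on `ℝ^{p+1}`. -/
def pdP (i : Fin (p + 1)) (g : Vp p → F') : Vp p → F' :=
  fun x => fderiv ℝ g x (Pi.single i 1)

/-- The Laplacian `Δ_{𝐱'} = Δ_{𝐱_p} + ∂_r²` on `ℝ^{p+2}`. -/
def LapSl (F : Sl p → F') : Sl p → F' :=
  fun z => ∑ i, pdSl p (i := i) (pdSl p i F) z + pdr p (pdr p F) z

/-- The Laplacian `Δ_𝐱` on `ℝ^{p+q+1}`. -/
def LapV (f : V p q → F') : V p q → F' :=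
  fun z => ∑ i, pdV1 p q i (pdV1 p q i f) z + ∑ j, pdV2 p q j (pdV2 p q j f) z

/-- The Laplacian `Δ_{𝐱_p}` on `ℝ^{p+1}`. -/
def LapP (g : Vp p → F') : Vp p → F' :=
  fun x => ∑ i, pdP p i (pdP p i g) x

end SliceOperators

/-- The generalized Cauchy–Riemann operator `D_{𝐱_p} = ∑_{i=0}^p e_i ∂_{x_i}`
on slice functions. -/
def DP (F : Sl p → A) : Sl p → A :=
  fun z => ∑ i, εp p q ξ i * pdSl p i F z

/-- The conjugated operator `D̄_{𝐱_p} = ∂_{x_0} - ∑_{i=1}^p e_i ∂_{x_i}`. -/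
def DPbar (F : Sl p → A) : Sl p → A :=
  fun z => pdSl p 0 F z - ∑ i : Fin p, eP p q ξ i * pdSl p i.succ F z

/-- The generalized Cauchy–Riemann (Dirac) operator `D_𝐱` on `ℝ^{p+q+1}`. -/
def DV (f : V p q → A) : V p q → A :=
  fun z => ∑ i, εp p q ξ i * pdV1 p q i f z + ∑ j, eQ p q ξ j * pdV2 p q j f z

/-- `D_{𝐱_p} = ∑_{i=0}^p e_i ∂_{x_i}` on functions on `ℝ^{p+1}`. -/
def DPfun (g : Vp p → A) : Vp p → A :=
  fun x => ∑ i, εp p q ξ i * pdP p i g x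

/-- The slice operator `D_ω = D_{𝐱_p} + ω ∂_r`, expressed on `ℝ^{p+q+1} ∖ ℝ^{p+1}`
(at `𝐱_q = 0` the radial part is junk `0`). -/
def Dslice (f : V p q → A) : V p q → A :=
  fun z => ∑ i, εp p q ξ i * pdV1 p q i f z
    + ωCl p q ξ (‖z.2‖⁻¹ • z.2) * fderiv ℝ f z (0, ‖z.2‖⁻¹ • z.2)

/-- The spherical Dirac operator `Γ = -∑_{i<j} e_i e_j L_{ij}` on the `ℝ^q` variables. -/
def sphericalDirac (f : V p q → A) : V p q → A :=
  fun z => - ∑ i : Fin q, ∑ j : Fin q,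
    if (i : ℕ) < (j : ℕ) then
      eQ p q ξ i * eQ p q ξ j *
        (z.2 i • pdV2 p q j f z - z.2 j • pdV2 p q i f z)
    else 0

/-- `f` is left generalized partial-slice monogenic of type `(p,q)` on `Ω`. -/
def GSMOn (Ω : Set (V p q)) (f : V p q → A) : Prop :=
  ∀ v ∈ S q,
    ContDiffOn ℝ 1 (fun z => f (spt p q v z)) (sliceSet p q Ω v) ∧
    ∀ z ∈ sliceSet p q Ω v,
      DP p q ξ (fun w => f (spt p q v w)) z
        + ωCl p q ξ v * pdr p (fun w => f (spt p q v w)) z = 0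

/-- `f` is (left) monogenic on `Ω`. -/
def MonogenicOn (Ω : Set (V p q)) (f : V p q → A) : Prop :=
  ContDiffOn ℝ 1 f Ω ∧ ∀ z ∈ Ω, DV p q ξ f z = 0

/-- `f` is the generalized partial-slice function on `Ω_D` with components `F1, F2`
(an even–odd pair in the last variable). -/
def IsGPSlice (D : Set (Sl p)) (f : V p q → A) (F1 F2 : Sl p → A) : Prop :=
  (∀ z ∈ D, F1 (z.1, -z.2) = F1 z ∧ F2 (z.1, -z.2) = -F2 z) ∧
  ∀ z ∈ D, ∀ v ∈ S q, f (spt p q v z) = F1 z + ωCl p q ξ v * F2 z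

/-- The generalized Cauchy–Riemann system (2.6) for the pair `(F1, F2)`. -/
def CRSystem (D : Set (Sl p)) (F1 F2 : Sl p → A) : Prop :=
  ∀ z ∈ D, DP p q ξ F1 z - pdr p F2 z = 0 ∧ DPbar p q ξ F2 z + pdr p F1 z = 0

/-- `f ∈ 𝒢𝒮ℛ(Ω_D)` with the given components. -/
def GSROnWith (D : Set (Sl p)) (f : V p q → A) (F1 F2 : Sl p → A) : Prop :=
  IsGPSlice p q ξ D f F1 F2 ∧ ContDiffOn ℝ 1 F1 D ∧ ContDiffOn ℝ 1 F2 D ∧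
    CRSystem p q ξ D F1 F2

/-- `f ∈ 𝒢𝒮ℛ(Ω_D)`. -/
def GSROn (D : Set (Sl p)) (f : V p q → A) : Prop :=
  ∃ F1 F2, GSROnWith p q ξ D f F1 F2

/-- Iterates `((1/r) ∂_r)^k F`. -/
def AIter (F : Sl p → A) : ℕ → Sl p → A
  | 0 => F
  | k + 1 => fun z => z.2⁻¹ • pdr p (AIter F k) z

/-- Iterates `(∂_r (1/r))^k F`. -/
def BIter (F : Sl p → A) : ℕ → Sl p → A
  | 0 => F
  | k + 1 => fun z => fderiv ℝ (fun w : Sl p => w.2⁻¹ • BIter F k w) z (0, 1)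

/-- `C_q(k) = (q-1)(q-3)⋯(q-2k+1)`. -/
def Cq (k : ℕ) : ℝ := ∏ j ∈ Finset.range k, ((q : ℝ) - (2 * (j : ℝ) + 1))

/-- The Fueter–Sce map `τ_q = (1/(q-1)!!) Δ^{(q-1)/2}` (for odd `q`). -/
def tauq (f : V p q → A) : V p q → A :=
  fun z => (((q - 1)‼ : ℝ))⁻¹ • (LapV p q)^[(q - 1) / 2] f z

/-- `(𝐱_q D_{𝐱_p})^k`, for a fixed Clifford element `u` in place of `𝐱_q`. -/
def uDpow (u : A) : ℕ → (Vp p → A) → Vp p → A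
  | 0 => fun g => g
  | k + 1 => fun g x => u * DPfun p q ξ (uDpow u k g) x

/-- The `k`-th term of the slice Cauchy–Kovalevskaya extension series. -/
def ckTerm (f₀ : Vp p → A) (k : ℕ) (z : V p q) : A :=
  ((k ! : ℝ))⁻¹ • uDpow p q ξ (ωCl p q ξ z.2) k f₀ z.1

/-- The slice Cauchy–Kovalevskaya extension `CK[f₀]`. -/
def CKext (f₀ : Vp p → A) (z : V p q) : A := ∑' k, ckTerm p q ξ f₀ k z

/-- The `k`-th term of the CK-extension for a fixed direction `w`. -/
def ckDirTerm (w : Vq q) (f₀ : Vp p → A) (k : ℕ) (z : V p q) : A :=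
  ((⟪w, z.2⟫) ^ k / (k ! : ℝ)) • uDpow p q ξ (ωCl p q ξ w) k f₀ z.1

/-- The CK-extension for a fixed direction `w ∈ 𝕊`. -/
def CKdir (w : Vq q) (f₀ : Vp p → A) (z : V p q) : A :=
  ∑' k, ckDirTerm p q ξ w f₀ k z

/-- The coefficients of the generalized CK-extension:
`f_{2k} = (Γ(q/2) / (2^{2k} k! Γ(k+q/2))) Δ^k f₀` and
`f_{2k+1} = (Γ(q/2) / (2^{2k+1} k! Γ(k+q/2+1))) D Δ^k f₀`. -/
def gckCoeff (f₀ : Vp p → A) (k : ℕ) : Vp p → A :=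
  if k % 2 = 0 then
    fun x => (Real.Gamma ((q : ℝ) / 2) /
        (2 ^ k * ((k / 2)! : ℝ) * Real.Gamma (((k / 2 : ℕ) : ℝ) + (q : ℝ) / 2))) •
      (LapP p)^[k / 2] f₀ x
  else
    fun x => (Real.Gamma ((q : ℝ) / 2) /
        (2 ^ k * ((k / 2)! : ℝ) * Real.Gamma (((k / 2 : ℕ) : ℝ) + (q : ℝ) / 2 + 1))) •
      DPfun p q ξ ((LapP p)^[k / 2] f₀) x

/-- The `k`-th term `𝐱_q^k f_k(𝐱_p)` of the generalized CK-extension series. -/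
def gckTerm (f₀ : Vp p → A) (k : ℕ) (z : V p q) : A :=
  (ωCl p q ξ z.2) ^ k * gckCoeff p q ξ f₀ k z.1

/-- The generalized CK-extension `GCK[f₀]`. -/
def GCKext (f₀ : Vp p → A) (z : V p q) : A := ∑' k, gckTerm p q ξ f₀ k z

/-- The Radon transform `R[f](𝐱_p, r, ω) = ∫_{⟨𝐱_q,ω⟩=r} f(𝐱_p, 𝐱_q) dσ(𝐱_q)`. -/
def radon (f : V p q → A) (x : Vp p) (r : ℝ) (w : Vq q) : A :=
  ∫ u : ((Submodule.span ℝ {w})ᗮ : Submodule ℝ (Vq q)),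
    f (x, r • w + (u : Vq q))

/-- The (suitably normalized) surface measure on the unit sphere of `ℝ^q`. -/
def sphMeasure : Measure (sphere (0 : Vq q) 1) := volume.toSphere

/-- The dual Radon transform
`Ř[f](𝐱_p, 𝐱_q) = (1/A_q) ∫_𝕊 f(𝐱_p, ⟨𝐱_q, η⟩ η) dS(η)` (a spherical average). -/
def dualRadon (f : V p q → A) (z : V p q) : A :=
  ⨍ w : sphere (0 : Vq q) 1,
    f (z.1, (⟪((w : Vq q)), z.2⟫) • (w : Vq q)) ∂(sphMeasure q)

end GPS

open GPS

namespace CliffordDirac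

section Averaging

variable {E F : Type*} [NormedAddCommGroup E] [NormedSpace ℝ E] [FiniteDimensional ℝ E]
  [MeasurableSpace E] [BorelSpace E] {μ : Measure E} [μ.IsAddHaarMeasure]
  [NormedAddCommGroup F] [NormedSpace ℝ F]

omit [NormedSpace ℝ E] [FiniteDimensional ℝ E] in
theorem integrable_smul_of_hasCompactSupport {ψ : E → ℝ} (hψ : Continuous ψ)
    (hc : HasCompactSupport ψ) {g : E → F} (hg : Continuous g) :
    Integrable (fun y => ψ y • g y) μ :=
  (hψ.smul hg).integrable_of_hasCompactSupport hc.smul_right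

/-- Differentiation of a weighted average of a function along moving affine points. -/
theorem hasDerivAt_integral_smul_comp_affine {ψ : E → ℝ} (hψ : Continuous ψ)
    (hc : HasCompactSupport ψ) {u : E → F} (hu : ContDiff ℝ 1 u) (hcu : HasCompactSupport u)
    {α β : E → E} (hα : Continuous α) (hβ : Continuous β) (t₀ : ℝ) :
    HasDerivAt (fun t : ℝ => ∫ y, ψ y • u (α y + t • β y) ∂μ)
      (∫ y, ψ y • fderiv ℝ u (α y + t₀ • β y) (β y) ∂μ) t₀ := by
  have hdu : Continuous (fderiv ℝ u) := hu.continuous_fderiv one_ne_zero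
  obtain ⟨C, hC⟩ := (hcu.fderiv (𝕜 := ℝ)).exists_bound_of_continuous hdu
  have hline : ∀ t : ℝ, Continuous fun y => α y + t • β y := fun t => by fun_prop
  refine (hasDerivAt_integral_of_dominated_loc_of_deriv_le
    (F' := fun t y => ψ y • fderiv ℝ u (α y + t • β y) (β y))
    (bound := fun y => ‖ψ y‖ * (C * ‖β y‖)) univ_mem
    (Eventually.of_forall fun t =>
      (hψ.smul (hu.continuous.comp (hline t))).aestronglyMeasurable)
    (integrable_smul_of_hasCompactSupport hψ hc (hu.continuous.comp (hline t₀)))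
    (hψ.smul ((hdu.comp (hline t₀)).clm_apply hβ)).aestronglyMeasurable
    (Eventually.of_forall fun y t _ => ?_) ?_
    (Eventually.of_forall fun y t _ => ?_)).2
  · rw [norm_smul]
    gcongr
    exact (ContinuousLinearMap.le_opNorm _ _).trans (by gcongr; exact hC _)
  · refine (by fun_prop : Continuous fun y => ‖ψ y‖ * (C * ‖β y‖)).integrable_of_hasCompactSupport ?_
    exact hc.norm.mul_right
  · have h1 : HasDerivAt (fun t : ℝ => α y + t • β y) (β y) t := by
      simpa using ((hasDerivAt_id t).smul_const (β y)).const_add (α y)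
    exact (((hu.differentiable one_ne_zero) _).hasFDerivAt.comp_hasDerivAt t h1).const_smul (ψ y)

/-- Integration by parts for a dilated and translated function against a test function. -/
theorem smul_integral_smul_fderiv_dilate {ψ : E → ℝ} (hψ : ContDiff ℝ 1 ψ)
    (hc : HasCompactSupport ψ) {u : E → F} (hu : ContDiff ℝ 1 u) (x w : E) (ε : ℝ) :
    ε • ∫ y, ψ y • fderiv ℝ u (x + ε • y) w ∂μ
      = -∫ y, fderiv ℝ ψ y w • u (x + ε • y) ∂μ := by
  have hline : Continuous fun y : E => x + ε • y := by fun_prop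
  have hder : ∀ y, HasFDerivAt (fun y => u (x + ε • y))
      (ε • fderiv ℝ u (x + ε • y)) y := fun y => by
    have h1 : HasFDerivAt (fun y : E => x + ε • y) (ε • ContinuousLinearMap.id ℝ E) y :=
      ((hasFDerivAt_id y).const_smul ε).const_add x
    refine (((hu.differentiable one_ne_zero) _).hasFDerivAt.comp y h1).congr_fderiv ?_
    ext v; simp
  have hfd : ∀ y, fderiv ℝ (fun y => u (x + ε • y)) y w = ε • fderiv ℝ u (x + ε • y) w :=
    fun y => by rw [(hder y).fderiv]; rfl
  have hdψ : Continuous fun y => fderiv ℝ ψ y w :=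
    (hψ.continuous_fderiv one_ne_zero).clm_apply continuous_const
  have hdu : Continuous fun y => fderiv ℝ u (x + ε • y) w :=
    ((hu.continuous_fderiv one_ne_zero).comp hline).clm_apply continuous_const
  rw [← integral_smul, ← integral_smul_fderiv_eq_neg_fderiv_smul_of_integrable]
  · simp only [hfd, smul_comm ε]
  · exact integrable_smul_of_hasCompactSupport hdψ (hc.fderiv_apply (𝕜 := ℝ) w)
      (hu.continuous.comp hline)
  · simp only [hfd]
    exact integrable_smul_of_hasCompactSupport hψ.continuous hc (hdu.const_smul ε)
  · exact integrable_smul_of_hasCompactSupport hψ.continuous hc (hu.continuous.comp hline)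
  · exact fun y _ => (hψ.differentiable one_ne_zero) y
  · exact fun y _ => (hder y).differentiableAt

theorem contDiff_integral_smul_dilate {ψ : E → ℝ} (hψ : Continuous ψ)
    {u : E → F} (hu : ContDiff ℝ 1 u) (hcu : HasCompactSupport u)
    {ε : ℝ} (hε : ε ≠ 0) :
    ContDiff ℝ 1 fun x => ∫ y, ψ y • u (x + ε • y) ∂μ := by
  have hU : ContDiff ℝ 1 fun z => u (ε • z) := hu.comp (contDiff_const_smul ε)
  have hUc : HasCompactSupport fun z => u (ε • z) := hcu.comp_smul hε
  have hψ' : Continuous fun y => ψ (-y) := hψ.comp continuous_neg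
  have hconv := hUc.contDiff_convolution_right (μ := μ) (n := 1) (ContinuousLinearMap.lsmul ℝ ℝ)
    hψ'.locallyIntegrable hU
  have hcomp : ContDiff ℝ 1 _ := hconv.comp (contDiff_const_smul ε⁻¹)
  convert hcomp using 1
  ext x
  simp only [Function.comp, convolution, ContinuousLinearMap.lsmul_apply]
  rw [← integral_neg_eq_self]
  simp [smul_smul, hε, sub_eq_add_neg]

end Averaging

section Bump

variable {E : Type*} [NormedAddCommGroup E] [InnerProductSpace ℝ E]

/-- A smooth radial bump function supported in the unit ball. -/
def radialBump (y : E) : ℝ := Real.smoothTransition (1 - ‖y‖ ^ 2)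

theorem contDiff_radialBump {n : ℕ∞} : ContDiff ℝ n (radialBump : E → ℝ) :=
  Real.smoothTransition.contDiff.comp (contDiff_const.sub (contDiff_norm_sq ℝ))

theorem continuous_radialBump : Continuous (radialBump : E → ℝ) :=
  (contDiff_radialBump (n := 0)).continuous

omit [InnerProductSpace ℝ E] in
theorem radialBump_eq_zero {y : E} (hy : 1 ≤ ‖y‖) : radialBump y = 0 :=
  Real.smoothTransition.zero_of_nonpos (by nlinarith)

theorem hasCompactSupport_radialBump [FiniteDimensional ℝ E] :
    HasCompactSupport (radialBump : E → ℝ) :=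
  HasCompactSupport.intro (isCompact_closedBall 0 1) fun y hy =>
    radialBump_eq_zero (by simpa using (not_le.1 (by simpa using hy) : 1 < ‖y‖).le)

theorem exists_fderiv_radialBump_eq (y : E) :
    ∃ c : ℝ, ∀ w, fderiv ℝ radialBump y w = c * ⟪y, w⟫ := by
  have h1 : HasFDerivAt (fun y : E => 1 - ‖y‖ ^ 2) (-(2 • innerSL ℝ y)) y :=
    (hasStrictFDerivAt_norm_sq y).hasFDerivAt.const_sub 1
  have h2 : DifferentiableAt ℝ Real.smoothTransition (1 - ‖y‖ ^ 2) :=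
    (Real.smoothTransition.contDiff (n := 1)).differentiable (by simp) _
  refine ⟨deriv Real.smoothTransition (1 - ‖y‖ ^ 2) * (-2), fun w => ?_⟩
  have h3 : HasFDerivAt (radialBump : E → ℝ) _ y := h2.hasDerivAt.comp_hasFDerivAt y h1
  rw [h3.fderiv]
  simp only [smul_apply, neg_apply, innerSL_apply_apply,
    smul_eq_mul, nsmul_eq_mul, Nat.cast_ofNat]
  ring

theorem integral_radialBump_pos [FiniteDimensional ℝ E] [MeasurableSpace E] [BorelSpace E]
    (μ : Measure E) [μ.IsAddHaarMeasure] : 0 < ∫ y, radialBump y ∂μ :=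
  continuous_radialBump.integral_pos_of_hasCompactSupport_nonneg_nonzero (x := 0)
    hasCompactSupport_radialBump (fun _ => Real.smoothTransition.nonneg _) (by simp [radialBump])

end Bump

section MeanValue

variable {ι B : Type*} [Fintype ι] [DecidableEq ι] [NormedRing B] [NormedAlgebra ℝ B]

/-- The Dirac-type operator `∑ i, a i ∂_i` on functions on a Euclidean space. -/
def dirac (a : ι → B) (u : EuclideanSpace ℝ ι → B) (z : EuclideanSpace ℝ ι) : B :=
  ∑ i, a i * fderiv ℝ u z (EuclideanSpace.single i 1)

/-- The Clifford-type relations under which `(∑ i, a' i ∂_i) (∑ i, a i ∂_i)` is the Laplacian. -/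
def FactorsLaplacian (a a' : ι → B) : Prop :=
  ∀ i j, a' i * a j + a' j * a i = if i = j then 2 else 0

variable {a a' : ι → B}

theorem FactorsLaplacian.trace_eq_zero (h : FactorsLaplacian a a') {T : ι → ι → B}
    (hsymm : ∀ i j, T i j = T j i) (hT : ∀ i, ∑ j, a j * T i j = 0) : ∑ i, T i i = 0 := by
  have h0 : ∑ i, ∑ j, a' i * (a j * T i j) = 0 := by simp [← Finset.mul_sum, hT]
  have h1 : ∑ i, ∑ j, a' j * (a i * T i j) = 0 := by
    rw [Finset.sum_comm, ← h0]
    simp only [hsymm]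
  have h2 : ∑ i, ∑ j, (a' i * a j + a' j * a i) * T i j = 0 := by
    simp only [add_mul, mul_assoc, Finset.sum_add_distrib, h0, h1, add_zero]
  simp only [h _ _, ite_mul, zero_mul, Finset.sum_ite_eq, Finset.mem_univ, if_true,
    ← Finset.mul_sum] at h2
  have h3 : (2 : ℝ) • ∑ i, T i i = 0 := by rwa [two_smul, ← two_mul]
  exact (smul_eq_zero.1 h3).resolve_left two_ne_zero

theorem integral_coord_smul_fderiv_comm {u : EuclideanSpace ℝ ι → B} (hu : ContDiff ℝ 1 u)
    (x : EuclideanSpace ℝ ι) {t : ℝ} (ht : t ≠ 0) (i j : ι) :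
    ∫ y : EuclideanSpace ℝ ι, (y i * radialBump y) •
        fderiv ℝ u (x + t • y) (EuclideanSpace.single j 1)
      = ∫ y : EuclideanSpace ℝ ι, (y j * radialBump y) •
        fderiv ℝ u (x + t • y) (EuclideanSpace.single i 1) := by
  have hk : ∀ i : ι, ContDiff ℝ 1 fun y : EuclideanSpace ℝ ι => y i * radialBump y := fun i =>
    (EuclideanSpace.proj (𝕜 := ℝ) i).contDiff.mul contDiff_radialBump
  have hder : ∀ i j (y : EuclideanSpace ℝ ι),
      fderiv ℝ (fun y : EuclideanSpace ℝ ι => y i * radialBump y) y (EuclideanSpace.single j 1)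
        = y i * fderiv ℝ radialBump y (EuclideanSpace.single j 1)
          + radialBump y * if i = j then 1 else 0 := fun i j y => by
    have h1 : HasFDerivAt (fun y : EuclideanSpace ℝ ι => y i)
        (EuclideanSpace.proj (𝕜 := ℝ) i) y :=
      (EuclideanSpace.proj (𝕜 := ℝ) i).hasFDerivAt
    have h2 := ((contDiff_radialBump (n := 1)).differentiable (by simp) y).hasFDerivAt
    rw [(h1.fun_mul h2).fderiv]
    simp
  refine smul_right_injective B ht ?_
  dsimp only
  rw [smul_integral_smul_fderiv_dilate (hk i) hasCompactSupport_radialBump.mul_left hu,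
    smul_integral_smul_fderiv_dilate (hk j) hasCompactSupport_radialBump.mul_left hu]
  congr 2
  ext y
  rw [hder, hder]
  obtain ⟨c, hc⟩ := exists_fderiv_radialBump_eq y
  simp only [hc, EuclideanSpace.inner_single_right, eq_comm (a := j) (b := i)]
  congr 1
  simp
  ring

variable [CompleteSpace B]

/-- The mean value property of null solutions of a Dirac-type operator. -/
theorem integral_radialBump_smul (h : FactorsLaplacian a a') {u : EuclideanSpace ℝ ι → B}
    (hu : ContDiff ℝ 1 u) (hcu : HasCompactSupport u) {x : EuclideanSpace ℝ ι} {R ε : ℝ}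
    (hsol : ∀ z ∈ ball x R, dirac a u z = 0) (hε : ε ∈ Set.Ioo 0 R) :
    ∫ y : EuclideanSpace ℝ ι, radialBump y • u (x + ε • y)
      = (∫ y : EuclideanSpace ℝ ι, radialBump y) • u x := by
  set M : ℝ → B := fun t => ∫ y : EuclideanSpace ℝ ι, radialBump y • u (x + t • y) with hM
  have hMd : ∀ t, HasDerivAt M (∫ y : EuclideanSpace ℝ ι,
      radialBump y • fderiv ℝ u (x + t • y) y) t := fun t =>
    hasDerivAt_integral_smul_comp_affine continuous_radialBump hasCompactSupport_radialBump hu hcu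
      continuous_const continuous_id t
  have hdu : ∀ (t : ℝ) w, Continuous fun y : EuclideanSpace ℝ ι => fderiv ℝ u (x + t • y) w :=
    fun t w => ((hu.continuous_fderiv one_ne_zero).comp (by fun_prop)).clm_apply continuous_const
  have hint : ∀ (t : ℝ) (i : ι) w, Integrable fun y : EuclideanSpace ℝ ι =>
      (y i * radialBump y) • fderiv ℝ u (x + t • y) w := fun t i w =>
    integrable_smul_of_hasCompactSupport
      ((EuclideanSpace.proj (𝕜 := ℝ) i).continuous.mul continuous_radialBump)
      hasCompactSupport_radialBump.mul_left (hdu t w)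
  have hzero : ∀ t ∈ Set.Ioo 0 R, deriv M t = 0 := fun t ht => by
    rw [(hMd t).deriv]
    have hexp : ∀ y : EuclideanSpace ℝ ι, radialBump y • fderiv ℝ u (x + t • y) y
        = ∑ i, (y i * radialBump y) • fderiv ℝ u (x + t • y) (EuclideanSpace.single i 1) :=
      fun y => by
        generalize fderiv ℝ u (x + t • y) = L
        have hy : L y = ∑ i, y i • L (EuclideanSpace.single i 1) := by
          conv_lhs => rw [← (EuclideanSpace.basisFun ι ℝ).sum_repr y]
          simp
        rw [hy, Finset.smul_sum]
        simp only [smul_smul, mul_comm]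
    simp only [hexp]
    rw [integral_finsetSum _ fun i _ => hint t i _]
    refine h.trace_eq_zero (T := fun i j => ∫ y : EuclideanSpace ℝ ι, (y i * radialBump y) •
      fderiv ℝ u (x + t • y) (EuclideanSpace.single j 1))
      (fun i j => integral_coord_smul_fderiv_comm hu x ht.1.ne' i j) fun i => ?_
    simp only [← integral_const_mul_of_integrable (hint t i _)]
    rw [← integral_finsetSum _ fun j _ => (hint t i _).const_mul _]
    refine integral_eq_zero_of_ae (Eventually.of_forall fun y => ?_)
    simp only [mul_smul_comm, ← Finset.smul_sum, Pi.zero_apply]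
    rcases le_or_gt 1 ‖y‖ with hy | hy
    · simp [radialBump_eq_zero hy]
    · refine smul_eq_zero_of_right _ (hsol _ ?_)
      rw [mem_ball, dist_self_add_left, norm_smul, Real.norm_of_nonneg ht.1.le]
      nlinarith [ht.1, ht.2]
  have hcont : Continuous M := continuous_iff_continuousAt.2 fun t => (hMd t).continuousAt
  have hconst : Set.EqOn M (fun _ => M ε) (Set.Ioo 0 R) := fun t ht =>
    isOpen_Ioo.is_const_of_deriv_eq_zero isPreconnected_Ioo
      (fun s _ => (hMd s).differentiableAt.differentiableWithinAt) hzero ht hε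
  have h0 : M 0 = M ε := by
    refine hconst.closure hcont continuous_const ?_
    rw [closure_Ioo (hε.1.trans hε.2).ne]
    exact ⟨le_rfl, (hε.1.trans hε.2).le⟩
  change M ε = _
  rw [← h0, ← integral_smul_const]
  simp [hM]

end MeanValue

section LocalSolutions

variable {ι B : Type*} [Fintype ι] [DecidableEq ι] [NormedRing B] [NormedAlgebra ℝ B]

/-- Continuously differentiable null solutions of a Dirac-type operator on a set. -/
def IsDiracSol (a : ι → B) (D : Set (EuclideanSpace ℝ ι)) (u : EuclideanSpace ℝ ι → B) : Prop :=
  ContDiffOn ℝ 1 u D ∧ ∀ z ∈ D, dirac a u z = 0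

theorem exists_contDiff_hasCompactSupport_eqOn {E F : Type*} [NormedAddCommGroup E]
    [InnerProductSpace ℝ E] [FiniteDimensional ℝ E] [NormedAddCommGroup F] [NormedSpace ℝ F]
    {u : E → F} {x : E} {r R : ℝ} (hu : ContDiffOn ℝ 1 u (ball x R)) (hr : 0 < r) (hrR : r < R) :
    ∃ v : E → F, ContDiff ℝ 1 v ∧ HasCompactSupport v ∧ Set.EqOn v u (ball x r) := by
  let η : ContDiffBump x := ⟨r, (r + R) / 2, hr, by linarith⟩
  refine ⟨fun z => η z • u z, contDiff_iff_contDiffAt.2 fun z => ?_,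
    η.hasCompactSupport.smul_right, fun z hz => ?_⟩
  · by_cases hz : z ∈ tsupport η
    · have hzR : z ∈ ball x R :=
        closedBall_subset_ball (by change (r + R) / 2 < R; linarith) (η.tsupport_eq ▸ hz)
      exact η.contDiffAt.smul (hu.contDiffAt (isOpen_ball.mem_nhds hzR))
    · have h0 : (fun z => η z • u z) =ᶠ[𝓝 z] fun _ => 0 := by
        filter_upwards [notMem_tsupport_iff_eventuallyEq.1 hz] with y hy
        simp [hy]
      exact contDiffAt_const.congr_of_eventuallyEq h0
  · simp [η.one_of_mem_closedBall (ball_subset_closedBall hz)]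

variable [CompleteSpace B] {a a' : ι → B}

theorem integral_radialBump_smul_fderiv (h : FactorsLaplacian a a') {u : EuclideanSpace ℝ ι → B}
    (hu : ContDiff ℝ 1 u) (hcu : HasCompactSupport u) {x : EuclideanSpace ℝ ι} {R ε : ℝ}
    (hsol : ∀ z ∈ ball x R, dirac a u z = 0) (hε : ε ∈ Set.Ioo 0 R) (w : EuclideanSpace ℝ ι) :
    (∫ y : EuclideanSpace ℝ ι, radialBump y) • fderiv ℝ u x w
      = -(ε⁻¹ • ∫ y : EuclideanSpace ℝ ι, fderiv ℝ radialBump y w • u (x + ε • y)) := by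
  have hparts := smul_integral_smul_fderiv_dilate (μ := volume) contDiff_radialBump
    (hasCompactSupport_radialBump (E := EuclideanSpace ℝ ι)) hu x w ε
  have hd := hasDerivAt_integral_smul_comp_affine (μ := volume) continuous_radialBump
    (hasCompactSupport_radialBump (E := EuclideanSpace ℝ ι)) hu hcu
    (α := fun y => x + ε • y) (β := fun _ => w) (by fun_prop) continuous_const 0
  have hline : HasDerivAt (fun t : ℝ => x + t • w) w 0 := by
    simpa using ((hasDerivAt_id (0 : ℝ)).smul_const w).const_add x
  have hd' : HasDerivAt (fun t : ℝ => (∫ y : EuclideanSpace ℝ ι, radialBump y) • u (x + t • w))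
      ((∫ y : EuclideanSpace ℝ ι, radialBump y) • fderiv ℝ u x w) 0 := by
    have h1 : HasFDerivAt u (fderiv ℝ u x) (x + (0 : ℝ) • w) := by
      simpa using (hu.differentiable one_ne_zero x).hasFDerivAt
    exact (h1.comp_hasDerivAt 0 hline).const_smul (∫ y : EuclideanSpace ℝ ι, radialBump y)
  have hnear : ∀ᶠ t : ℝ in 𝓝 0, x + t • w ∈ ball x ((R - ε) / 2) := by
    refine hline.continuousAt (isOpen_ball.mem_nhds ?_)
    simpa using hε.2
  have heq : (fun t : ℝ => (∫ y : EuclideanSpace ℝ ι, radialBump y) • u (x + t • w)) =ᶠ[𝓝 0]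
      fun t => ∫ y : EuclideanSpace ℝ ι, radialBump y • u (x + ε • y + t • w) := by
    filter_upwards [hnear] with t ht
    rw [← integral_radialBump_smul h hu hcu (R := (R + ε) / 2) (ε := ε) (x := x + t • w)
      (fun z hz => hsol z ?_) ⟨hε.1, by linarith [hε.2]⟩]
    · simp only [add_right_comm]
    · rw [mem_ball] at *
      linarith [dist_triangle z (x + t • w) x]
  rw [hd'.unique (hd.congr_of_eventuallyEq heq)]
  simp only [zero_smul, add_zero]
  rw [← smul_neg, ← hparts, inv_smul_smul₀ hε.1.ne']

theorem IsDiracSol.contDiffOn_fderiv_apply (h : FactorsLaplacian a a')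
    {D : Set (EuclideanSpace ℝ ι)} (hD : IsOpen D) {u : EuclideanSpace ℝ ι → B}
    (hu : IsDiracSol a D u) (w : EuclideanSpace ℝ ι) :
    ContDiffOn ℝ 1 (fun z => fderiv ℝ u z w) D := by
  intro x hx
  obtain ⟨R, hR, hRD⟩ := Metric.isOpen_iff.1 hD x hx
  obtain ⟨v, hv, hcv, hvu⟩ := exists_contDiff_hasCompactSupport_eqOn (hu.1.mono hRD)
    (half_pos hR) (half_lt_self hR)
  have hfd : ∀ z ∈ ball x (R / 2), fderiv ℝ v z = fderiv ℝ u z := fun z hz =>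
    (hvu.eventuallyEq_of_mem (isOpen_ball.mem_nhds hz)).fderiv_eq
  have hsol : ∀ z ∈ ball x (R / 2), dirac a v z = 0 := fun z hz => by
    rw [dirac, hfd z hz]
    exact hu.2 z (hRD (ball_subset_ball (by linarith) hz))
  have hc := (integral_radialBump_pos (volume : Measure (EuclideanSpace ℝ ι))).ne'
  set c := ∫ y : EuclideanSpace ℝ ι, radialBump y
  have hsmooth : ContDiff ℝ 1 fun z => c⁻¹ • -((R / 8)⁻¹ • ∫ y : EuclideanSpace ℝ ι,
      fderiv ℝ radialBump y w • v (z + (R / 8) • y)) :=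
    ((contDiff_integral_smul_dilate (((contDiff_radialBump (n := 1)).continuous_fderiv
      (by simp)).clm_apply continuous_const) hv hcv (by positivity)).const_smul _).neg.const_smul _
  refine (hsmooth.contDiffAt.congr_of_eventuallyEq ?_).contDiffWithinAt
  filter_upwards [ball_mem_nhds x (by positivity : 0 < R / 4)] with z hz
  rw [← integral_radialBump_smul_fderiv h hv hcv (R := R / 4) (fun y hy => hsol y ?_)
    ⟨by positivity, by linarith⟩, inv_smul_smul₀ hc,
    hfd z (ball_subset_ball (by linarith) hz)]
  rw [mem_ball] at *
  linarith [dist_triangle y z x]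

theorem IsDiracSol.fderiv_apply (h : FactorsLaplacian a a')
    {D : Set (EuclideanSpace ℝ ι)} (hD : IsOpen D) {u : EuclideanSpace ℝ ι → B}
    (hu : IsDiracSol a D u) (w : EuclideanSpace ℝ ι) :
    IsDiracSol a D fun z => fderiv ℝ u z w := by
  refine ⟨hu.contDiffOn_fderiv_apply h hD w, fun z hz => ?_⟩
  have hd1 : ContDiffOn ℝ 1 (fderiv ℝ u) D :=
    contDiffOn_clm_apply.2 (hu.contDiffOn_fderiv_apply h hD)
  have hd2 : ContDiffOn ℝ 2 u D :=
    (contDiffOn_succ_iff_fderiv_of_isOpen (n := 1) hD).2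
      ⟨hu.1.differentiableOn one_ne_zero, by simp, hd1⟩
  have hsymm : IsSymmSndFDerivAt ℝ u z :=
    (hd2.contDiffAt (hD.mem_nhds hz)).isSymmSndFDerivAt (by simp)
  have hdd : DifferentiableAt ℝ (fderiv ℝ u) z :=
    (hd1.contDiffAt (hD.mem_nhds hz)).differentiableAt one_ne_zero
  have happ : ∀ w, HasFDerivAt (fun z => fderiv ℝ u z w)
      ((fderiv ℝ (fderiv ℝ u) z).flip w) z := fun w => by
    simpa using hdd.hasFDerivAt.clm_apply (hasFDerivAt_const w z)
  have hsum : HasFDerivAt (dirac a u) (∑ i, a i • (fderiv ℝ (fderiv ℝ u) z).flip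
      (EuclideanSpace.single i 1)) z :=
    HasFDerivAt.fun_sum fun i _ => (happ _).const_mul (a i)
  have hzero : dirac a u =ᶠ[𝓝 z] fun _ => 0 := by
    filter_upwards [hD.mem_nhds hz] with y hy using hu.2 y hy
  have h0 := hsum.unique ((hasFDerivAt_const (0 : B) z).congr_of_eventuallyEq hzero)
  have h1 := DFunLike.congr_fun h0 w
  simp only [dirac, (happ _).fderiv]
  simpa [hsymm.eq w] using h1

/-- Interior gradient estimate for null solutions of a Dirac-type operator. -/
theorem exists_norm_fderiv_apply_le (h : FactorsLaplacian a a') :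
    ∃ C : ℝ, 0 ≤ C ∧ ∀ (D : Set (EuclideanSpace ℝ ι)) (u : EuclideanSpace ℝ ι → B),
      IsDiracSol a D u → ∀ (x w : EuclideanSpace ℝ ι) (R M : ℝ), 0 < R → ball x R ⊆ D →
        (∀ z ∈ ball x R, ‖u z‖ ≤ M) → ‖fderiv ℝ u x w‖ ≤ C * ‖w‖ / R * M := by
  have hc := integral_radialBump_pos (volume : Measure (EuclideanSpace ℝ ι))
  set c := ∫ y : EuclideanSpace ℝ ι, radialBump y
  set ρ : EuclideanSpace ℝ ι → ℝ := radialBump with hρ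
  have hdρ : Continuous (fderiv ℝ ρ) := (contDiff_radialBump (n := 1)).continuous_fderiv (by simp)
  have hcρ : HasCompactSupport (fderiv ℝ ρ) := hasCompactSupport_radialBump.fderiv (𝕜 := ℝ)
  have hint : Integrable fun y => ‖fderiv ℝ ρ y‖ :=
    hdρ.norm.integrable_of_hasCompactSupport hcρ.norm
  refine ⟨2 * (c⁻¹ * ∫ y, ‖fderiv ℝ ρ y‖),
    mul_nonneg two_pos.le (mul_nonneg (inv_nonneg.2 hc.le) (integral_nonneg fun y => norm_nonneg _)),
    fun D u hu x w R M hR hRD hM => ?_⟩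
  obtain ⟨v, hv, hcv, hvu⟩ := exists_contDiff_hasCompactSupport_eqOn (r := 3 * R / 4)
    (hu.1.mono hRD) (by positivity) (by linarith)
  have hfd : ∀ z ∈ ball x (3 * R / 4), fderiv ℝ v z = fderiv ℝ u z := fun z hz =>
    (hvu.eventuallyEq_of_mem (isOpen_ball.mem_nhds hz)).fderiv_eq
  have hsub : ball x (3 * R / 4) ⊆ ball x R := ball_subset_ball (by linarith)
  have hrep := integral_radialBump_smul_fderiv h hv hcv (R := 3 * R / 4) (ε := R / 2)
    (fun z hz => by rw [dirac, hfd z hz]; exact hu.2 z (hRD (hsub hz)))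
    ⟨by positivity, by linarith⟩ w
  rw [hfd x (mem_ball_self (by positivity))] at hrep
  have hbound : ‖∫ y, fderiv ℝ ρ y w • v (x + (R / 2) • y)‖
      ≤ ∫ y, ‖fderiv ℝ ρ y‖ * (‖w‖ * M) := by
    refine norm_integral_le_of_norm_le (hint.mul_const _) (Eventually.of_forall fun y => ?_)
    rcases le_or_gt ‖y‖ 1 with hy | hy
    · have hmem : x + (R / 2) • y ∈ ball x (3 * R / 4) := by
        rw [mem_ball, dist_self_add_left, norm_smul, Real.norm_of_nonneg (by positivity)]
        nlinarith
      rw [norm_smul, ← mul_assoc]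
      gcongr
      · exact (fderiv ℝ ρ y).le_opNorm w
      · rw [hvu hmem]
        exact hM _ (hsub hmem)
    · have hy0 : fderiv ℝ ρ y = 0 := by
        have : ρ =ᶠ[𝓝 y] fun _ => 0 := by
          filter_upwards [continuous_norm.continuousAt.eventually (lt_mem_nhds hy)] with z hz
          exact radialBump_eq_zero hz.le
        rw [this.fderiv_eq]
        simp
      simp [hy0]
  rw [integral_mul_const] at hbound
  have hnorm := congrArg norm hrep
  rw [norm_smul, norm_neg, norm_smul, Real.norm_of_nonneg hc.le,
    Real.norm_of_nonneg (by positivity : 0 ≤ (R / 2)⁻¹)] at hnorm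
  calc ‖fderiv ℝ u x w‖ = c⁻¹ * (c * ‖fderiv ℝ u x w‖) := by field_simp
    _ ≤ c⁻¹ * ((R / 2)⁻¹ * ((∫ y, ‖fderiv ℝ ρ y‖) * (‖w‖ * M))) := by
        rw [hnorm]; gcongr
    _ = _ := by field_simp

end LocalSolutions

section Identity

variable {ι B : Type*} [Fintype ι] [DecidableEq ι] [NormedRing B] [NormedAlgebra ℝ B]

theorem norm_le_of_hasDerivAt_chain {F : Type*} [NormedAddCommGroup F] [NormedSpace ℝ F] {K : ℝ}
    (n : ℕ) {g : ℕ → ℝ → F}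
    (hg : ∀ k, ∀ t ∈ Set.Icc (0 : ℝ) 1, HasDerivAt (g k) (g (k + 1) t) t)
    (h0 : ∀ k, g k 0 = 0) (hK : ∀ t ∈ Set.Icc (0 : ℝ) 1, ‖g n t‖ ≤ K) :
    ∀ t ∈ Set.Icc (0 : ℝ) 1, ‖g 0 t‖ ≤ K * (t ^ n / n !) := by
  induction n generalizing g with
  | zero => simpa using hK
  | succ n ih =>
    have h1 := ih (g := fun k => g (k + 1)) (fun k => hg (k + 1)) (fun k => h0 (k + 1)) hK
    refine fun t ht => image_norm_le_of_norm_deriv_right_le_deriv_boundary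
      (B := fun t => K * (t ^ (n + 1) / (n + 1)!)) (B' := fun t => K * (t ^ n / n !))
      (fun t ht => (hg 0 t ht).continuousAt.continuousWithinAt)
      (fun t ht => (hg 0 t ⟨ht.1, ht.2.le⟩).hasDerivWithinAt) (by simp [h0]) (fun t => ?_)
      (fun t ht => h1 t ⟨ht.1, ht.2.le⟩) ht
    have hfac : K * (t ^ n / n !) = K * (((n + 1 : ℕ) : ℝ) * t ^ (n + 1 - 1) / (n + 1)!) := by
      rw [Nat.factorial_succ, Nat.add_sub_cancel]
      push_cast
      field_simp
    rw [hfac]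
    exact ((hasDerivAt_pow (n + 1) t).div_const ((n + 1)! : ℝ)).const_mul K

/-- The directional derivative `∂_w`. -/
def dirDeriv (w : EuclideanSpace ℝ ι) (u : EuclideanSpace ℝ ι → B) : EuclideanSpace ℝ ι → B :=
  fun z => fderiv ℝ u z w

omit [Fintype ι] [DecidableEq ι] in
theorem iterate_dirDeriv_eq_zero {u : EuclideanSpace ℝ ι → B} {x : EuclideanSpace ℝ ι}
    (hu : u =ᶠ[𝓝 x] 0) (w : EuclideanSpace ℝ ι) (n : ℕ) : (dirDeriv w)^[n] u x = 0 := by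
  suffices h : (dirDeriv w)^[n] u =ᶠ[𝓝 x] 0 from h.eq_of_nhds
  induction n generalizing u with
  | zero => exact hu
  | succ n ih =>
    refine ih ?_
    filter_upwards [hu.eventuallyEq_nhds] with y hy
    rw [dirDeriv, hy.fderiv_eq]
    simp

variable [CompleteSpace B] {a a' : ι → B}

theorem IsDiracSol.iterate_dirDeriv (h : FactorsLaplacian a a') {D : Set (EuclideanSpace ℝ ι)}
    (hD : IsOpen D) {u : EuclideanSpace ℝ ι → B} (hu : IsDiracSol a D u)
    (w : EuclideanSpace ℝ ι) (n : ℕ) : IsDiracSol a D ((dirDeriv w)^[n] u) := by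
  induction n generalizing u with
  | zero => exact hu
  | succ n ih => exact ih (hu.fderiv_apply h hD w)

theorem exists_norm_iterate_dirDeriv_le (h : FactorsLaplacian a a') :
    ∃ C : ℝ, 0 ≤ C ∧ ∀ (D : Set (EuclideanSpace ℝ ι)), IsOpen D → ∀ (w : EuclideanSpace ℝ ι)
      (R : ℝ), 0 < R → ∀ (n : ℕ) (u : EuclideanSpace ℝ ι → B) (M : ℝ) (x : EuclideanSpace ℝ ι),
      IsDiracSol a D u → ball x ((n + 1) * R) ⊆ D → (∀ z ∈ ball x ((n + 1) * R), ‖u z‖ ≤ M) →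
      ‖(dirDeriv w)^[n] u x‖ ≤ (C * ‖w‖ / R) ^ n * M := by
  obtain ⟨C, hC, hCb⟩ := exists_norm_fderiv_apply_le h
  refine ⟨C, hC, fun D hD w R hR n => ?_⟩
  induction n with
  | zero => intro u M x _ _ hM; simpa using hM x (mem_ball_self (by simpa using hR))
  | succ n ih =>
    intro u M x hu hxD hM
    push_cast at hxD hM
    have hsub : ∀ z ∈ ball x ((n + 1) * R), ball z R ⊆ ball x ((n + 1 + 1) * R) :=
      fun z hz => ball_subset_ball' (by rw [mem_ball] at hz; linarith)
    rw [pow_succ, mul_assoc]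
    exact ih (dirDeriv w u) _ x (hu.fderiv_apply h hD w)
      ((ball_subset_ball (by nlinarith)).trans hxD) fun z hz =>
      hCb D u hu z w R M hR ((hsub z hz).trans hxD) fun y hy => hM y (hsub z hz hy)

/-- Null solutions of a Dirac-type operator are locally determined by their derivatives at a
point, uniformly on balls. -/
theorem exists_eq_zero_of_iterate_dirDeriv_eq_zero (h : FactorsLaplacian a a') :
    ∃ δ : ℝ, 0 < δ ∧ δ ≤ 1 / 2 ∧ ∀ (D : Set (EuclideanSpace ℝ ι)), IsOpen D →
      ∀ (u : EuclideanSpace ℝ ι → B) (x w : EuclideanSpace ℝ ι) (R M : ℝ), IsDiracSol a D u →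
      0 < R → ball x R ⊆ D → (∀ z ∈ ball x R, ‖u z‖ ≤ M) → ‖w‖ ≤ δ * R →
      (∀ n, (dirDeriv w)^[n] u x = 0) → u (x + w) = 0 := by
  obtain ⟨C, hC, hCb⟩ := exists_norm_iterate_dirDeriv_le h
  have he : 1 ≤ Real.exp 1 := Real.one_le_exp zero_le_one
  refine ⟨1 / (4 * Real.exp 1 * (C + 1)), by positivity,
    one_div_le_one_div_of_le two_pos (by nlinarith), ?_⟩
  set δ := 1 / (4 * Real.exp 1 * (C + 1)) with hδ
  have hδ2 : δ ≤ 1 / 2 := one_div_le_one_div_of_le two_pos (by nlinarith)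
  have hδ0 : 0 < δ := by positivity
  intro D hD u x w R M hu hR hxD hM hw h0
  have hM0 : 0 ≤ M := (norm_nonneg _).trans (hM x (mem_ball_self hR))
  have hseg : ∀ t ∈ Set.Icc (0 : ℝ) 1, ball (x + t • w) (R / 2) ⊆ ball x R := fun t ht =>
    ball_subset_ball' (by
      rw [dist_self_add_left, norm_smul, Real.norm_of_nonneg ht.1]
      nlinarith [ht.2, norm_nonneg w])
  have hmem : ∀ t ∈ Set.Icc (0 : ℝ) 1, x + t • w ∈ D := fun t ht =>
    hxD (hseg t ht (mem_ball_self (half_pos hR)))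
  have hg : ∀ k, ∀ t ∈ Set.Icc (0 : ℝ) 1, HasDerivAt (fun t : ℝ => (dirDeriv w)^[k] u (x + t • w))
      ((dirDeriv w)^[k + 1] u (x + t • w)) t := fun k t ht => by
    rw [Function.iterate_succ_apply']
    have hline : HasDerivAt (fun t : ℝ => x + t • w) w t := by
      simpa using ((hasDerivAt_id t).smul_const w).const_add x
    exact ((hu.iterate_dirDeriv h hD w k).1.contDiffAt (hD.mem_nhds (hmem t ht))
      |>.differentiableAt one_ne_zero).hasFDerivAt.comp_hasDerivAt t hline
  have key : ∀ n : ℕ, ‖u (x + w)‖ ≤ Real.exp 1 * M * (1 / 2) ^ n := fun n => by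
    have hn : (0 : ℝ) < n + 1 := by positivity
    have hrad : ((n : ℝ) + 1) * (R / 2 / (n + 1)) = R / 2 := by field_simp
    have h1 := norm_le_of_hasDerivAt_chain (K := (C * ‖w‖ / (R / 2 / (n + 1))) ^ n * M) n hg
      (fun k => by simpa using h0 k) (fun t ht => by
        refine hCb D hD w (R / 2 / (n + 1)) (by positivity) n u M _ hu ?_ ?_ <;> rw [hrad]
        · exact (hseg t ht).trans hxD
        · exact fun z hz => hM z (hseg t ht hz)) 1 (by simp)
    simp only [Function.iterate_zero, id_eq, one_smul, one_pow] at h1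
    have h2 : C * ‖w‖ / (R / 2 / (n + 1)) ≤ (2 * C * δ) * (n + 1) := by
      rw [div_le_iff₀ (by positivity)]
      have : 2 * C * δ * (n + 1) * (R / 2 / (n + 1)) = C * (δ * R) := by field_simp
      rw [this]
      gcongr
    have h3 : ((n : ℝ) + 1) ^ n / n ! ≤ Real.exp 1 * Real.exp 1 ^ n := by
      rw [← pow_succ', ← Real.exp_nat_mul]
      push_cast
      rw [mul_one]
      exact Real.pow_div_factorial_le_exp _ hn.le n
    have h4 : 2 * C * δ * Real.exp 1 ≤ 1 / 2 := by
      rw [hδ]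
      field_simp
      nlinarith
    calc ‖u (x + w)‖ ≤ (C * ‖w‖ / (R / 2 / (n + 1))) ^ n * M * (1 / n !) := h1
      _ ≤ ((2 * C * δ) * (n + 1)) ^ n * M * (1 / n !) := by gcongr
      _ = (2 * C * δ) ^ n * M * (((n : ℝ) + 1) ^ n / n !) := by rw [mul_pow]; ring
      _ ≤ (2 * C * δ) ^ n * M * (Real.exp 1 * Real.exp 1 ^ n) := by gcongr
      _ = Real.exp 1 * M * (2 * C * δ * Real.exp 1) ^ n := by rw [mul_pow _ (Real.exp 1)]; ring
      _ ≤ _ := by gcongr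
  have hlim : Tendsto (fun n : ℕ => Real.exp 1 * M * (1 / 2 : ℝ) ^ n) atTop (𝓝 0) := by
    simpa using (tendsto_pow_atTop_nhds_zero_of_lt_one (by norm_num : (0 : ℝ) ≤ 1 / 2)
      (by norm_num)).const_mul (Real.exp 1 * M)
  exact norm_le_zero_iff.1 (ge_of_tendsto' hlim key)

omit [DecidableEq ι] [NormedAlgebra ℝ B] [CompleteSpace B] in
theorem exists_ball_subset_norm_le {D : Set (EuclideanSpace ℝ ι)} (hD : IsOpen D)
    {u : EuclideanSpace ℝ ι → B} (hu : ContinuousOn u D) {x : EuclideanSpace ℝ ι} (hx : x ∈ D) :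
    ∃ R M : ℝ, 0 < R ∧ ball x R ⊆ D ∧ ∀ z ∈ ball x R, ‖u z‖ ≤ M := by
  obtain ⟨R, hR, hRD⟩ := nhds_basis_closedBall.mem_iff.1 (hD.mem_nhds hx)
  obtain ⟨M, hM⟩ := (isCompact_closedBall x R).exists_bound_of_continuousOn (hu.mono hRD)
  exact ⟨R, M, hR, ball_subset_closedBall.trans hRD, fun z hz => hM z (ball_subset_closedBall hz)⟩

/-- The identity theorem for null solutions of a Dirac-type operator. -/
theorem IsDiracSol.eqOn_zero_of_eventuallyEq (h : FactorsLaplacian a a')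
    {D : Set (EuclideanSpace ℝ ι)} (hD : IsOpen D) (hDc : IsPreconnected D)
    {u : EuclideanSpace ℝ ι → B} (hu : IsDiracSol a D u) {x₀ : EuclideanSpace ℝ ι} (hx₀ : x₀ ∈ D)
    (h0 : u =ᶠ[𝓝 x₀] 0) : Set.EqOn u 0 D := by
  obtain ⟨δ, hδ0, hδ2, hδ⟩ := exists_eq_zero_of_iterate_dirDeriv_eq_zero h
  suffices hsub : D ⊆ {z | u =ᶠ[𝓝 z] 0} from fun z hz => (hsub hz).eq_of_nhds
  refine hDc.subset_of_closure_inter_subset isOpen_setOfPred_eventually_nhds ⟨x₀, hx₀, h0⟩ ?_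
  rintro x ⟨hxc, hxD⟩
  obtain ⟨R, M, hR, hRD, hM⟩ := exists_ball_subset_norm_le hD hu.1.continuousOn hxD
  obtain ⟨y, hy, hxy⟩ := Metric.mem_closure_iff.1 hxc (δ * R / 4) (by positivity)
  rw [dist_comm] at hxy
  have hsub : ball y (R / 2) ⊆ ball x R := ball_subset_ball' (by nlinarith)
  filter_upwards [ball_mem_nhds x (by positivity : 0 < δ * R / 4)] with z hz
  have := hδ D hD u y (z - y) (R / 2) M hu (half_pos hR) (hsub.trans hRD)
    (fun z hz => hM z (hsub hz))
    (by rw [← dist_eq_norm, mem_ball] at *; linarith [dist_triangle_right z y x])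
    (iterate_dirDeriv_eq_zero hy _)
  simpa using this

omit [CompleteSpace B] in
theorem IsDiracSol.fderiv_eq_zero_of_eqOn_hyperplane (h : FactorsLaplacian a a')
    {D : Set (EuclideanSpace ℝ ι)} (hD : IsOpen D) {u : EuclideanSpace ℝ ι → B}
    (hu : IsDiracSol a D u) {i₀ : ι} (h0 : ∀ z ∈ D, z i₀ = 0 → u z = 0)
    {z : EuclideanSpace ℝ ι} (hz : z ∈ D) (hz0 : z i₀ = 0) :
    fderiv ℝ u z (EuclideanSpace.single i₀ 1) = 0 := by
  have htan : ∀ j, j ≠ i₀ → fderiv ℝ u z (EuclideanSpace.single j 1) = 0 := fun j hj => by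
    have hline : HasDerivAt (fun t : ℝ => z + t • EuclideanSpace.single j (1 : ℝ))
        (EuclideanSpace.single j 1) 0 := by
      simpa using ((hasDerivAt_id (0 : ℝ)).smul_const (EuclideanSpace.single j (1 : ℝ))).const_add z
    have h1 : HasFDerivAt u (fderiv ℝ u z) (z + (0 : ℝ) • EuclideanSpace.single j (1 : ℝ)) := by
      simpa using ((hu.1.contDiffAt (hD.mem_nhds hz)).differentiableAt one_ne_zero).hasFDerivAt
    have h2 := h1.comp_hasDerivAt 0 hline
    have h3 : (u ∘ fun t : ℝ => z + t • EuclideanSpace.single j (1 : ℝ)) =ᶠ[𝓝 0] fun _ => 0 := by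
      filter_upwards [hline.continuousAt (hD.mem_nhds (by simpa using hz))] with t ht
      refine h0 _ ht ?_
      simp [hz0, hj.symm]
    exact h2.unique ((hasDerivAt_const (0 : ℝ) (0 : B)).congr_of_eventuallyEq h3)
  have h1 := hu.2 z hz
  rw [dirac, Finset.sum_eq_single i₀ (fun j _ hj => by rw [htan j hj, mul_zero]) (by simp)] at h1
  have h2 : (a' i₀ * a i₀ + a' i₀ * a i₀) * fderiv ℝ u z (EuclideanSpace.single i₀ 1) = 0 := by
    simp only [add_mul, mul_assoc, h1, mul_zero, add_zero]
  rw [h i₀ i₀, if_pos rfl, two_mul, ← two_smul ℝ] at h2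
  exact (smul_eq_zero.1 h2).resolve_left two_ne_zero

/-- A null solution of a Dirac-type operator vanishing on a hyperplane vanishes identically. -/
theorem IsDiracSol.eqOn_zero_of_eqOn_hyperplane (h : FactorsLaplacian a a')
    {D : Set (EuclideanSpace ℝ ι)} (hD : IsOpen D) (hDc : IsPreconnected D)
    {u : EuclideanSpace ℝ ι → B} (hu : IsDiracSol a D u) {i₀ : ι} {z₀ : EuclideanSpace ℝ ι}
    (hz₀ : z₀ ∈ D) (hz₀0 : z₀ i₀ = 0) (h0 : ∀ z ∈ D, z i₀ = 0 → u z = 0) : Set.EqOn u 0 D := by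
  have hiter : ∀ (t : ℝ) (n : ℕ), ∀ z ∈ D, z i₀ = 0 →
      (dirDeriv (t • EuclideanSpace.single i₀ (1 : ℝ)))^[n] u z = 0 := fun t n => by
    induction n with
    | zero => exact h0
    | succ n ih =>
      intro z hz hz0
      rw [Function.iterate_succ_apply', dirDeriv, map_smul,
        (hu.iterate_dirDeriv h hD _ n).fderiv_eq_zero_of_eqOn_hyperplane h hD ih hz hz0, smul_zero]
  obtain ⟨δ, hδ0, hδ2, hδ⟩ := exists_eq_zero_of_iterate_dirDeriv_eq_zero h
  refine hu.eqOn_zero_of_eventuallyEq h hD hDc hz₀ ?_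
  obtain ⟨R, M, hR, hRD, hM⟩ := exists_ball_subset_norm_le hD hu.1.continuousOn hz₀
  filter_upwards [ball_mem_nhds z₀ (by positivity : 0 < δ * R / 4)] with z hz
  rw [mem_ball, dist_eq_norm] at hz
  set w : EuclideanSpace ℝ ι := z i₀ • EuclideanSpace.single i₀ (1 : ℝ) with hw
  have hwn : ‖w‖ ≤ ‖z - z₀‖ := by
    simpa [hw, norm_smul, hz₀0] using PiLp.norm_apply_le (z - z₀) i₀
  have hy : dist (z - w) z₀ < R / 2 := by
    rw [dist_eq_norm, sub_right_comm]
    have := norm_sub_le (z - z₀) w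
    nlinarith
  have hsub : ball (z - w) (R / 2) ⊆ ball z₀ R := ball_subset_ball' (by linarith)
  have := hδ D hD u (z - w) w (R / 2) M hu (half_pos hR) (hsub.trans hRD)
    (fun z hz => hM z (hsub hz)) (by nlinarith [mul_pos hδ0 hR]) fun n => hiter _ n _
      (hRD (hsub (mem_ball_self (half_pos hR)))) (by simp [hw])
  simpa using this

end Identity

section Transfer

variable {A : Type*} [NormedRing A] [NormedAlgebra ℝ A]

instance completionNormedAlgebra : NormedAlgebra ℝ (UniformSpace.Completion A) where
  norm_smul_le := norm_smul_le

theorem IsDiracSol.eqOn_zero_of_eqOn_hyperplane_of_incomplete {ι : Type*} [Fintype ι]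
    [DecidableEq ι] {a a' : ι → A} (h : FactorsLaplacian a a')
    {D : Set (EuclideanSpace ℝ ι)} (hD : IsOpen D) (hDc : IsPreconnected D)
    {u : EuclideanSpace ℝ ι → A} (hu : IsDiracSol a D u) {i₀ : ι} {z₀ : EuclideanSpace ℝ ι}
    (hz₀ : z₀ ∈ D) (hz₀0 : z₀ i₀ = 0) (h0 : ∀ z ∈ D, z i₀ = 0 → u z = 0) : Set.EqOn u 0 D := by
  let J : A →L[ℝ] UniformSpace.Completion A := UniformSpace.Completion.toComplL
  have hJ : ∀ x, J x = x := fun _ => rfl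
  have hh : FactorsLaplacian (fun i => J (a i)) (fun i => J (a' i)) := fun i j => by
    simp only [hJ, ← UniformSpace.Completion.coe_mul, ← UniformSpace.Completion.coe_add, h i j]
    split_ifs
    · rw [← one_add_one_eq_two, ← one_add_one_eq_two, UniformSpace.Completion.coe_add,
        UniformSpace.Completion.coe_one]
    · exact UniformSpace.Completion.coe_zero
  have hsol : IsDiracSol (fun i => J (a i)) D (J ∘ u) := by
    refine ⟨J.contDiff.comp_contDiffOn hu.1, fun z hz => ?_⟩
    have hd := (hu.1.contDiffAt (hD.mem_nhds hz)).differentiableAt one_ne_zero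
    have h1 := congrArg J (hu.2 z hz)
    rw [dirac, map_sum, map_zero] at h1
    rw [dirac, (J.hasFDerivAt.comp z hd.hasFDerivAt).fderiv, ← h1]
    refine Finset.sum_congr rfl fun i _ => ?_
    simp only [ContinuousLinearMap.comp_apply, hJ, UniformSpace.Completion.coe_mul]
  intro z hz
  have h2 := hsol.eqOn_zero_of_eqOn_hyperplane hh hD hDc hz₀ hz₀0
    (fun z hz hz0 => by simp [h0 z hz hz0]) hz
  exact UniformSpace.Completion.coe_injective A (by simpa [hJ] using h2)

/-- Splitting off the last coordinate of a Euclidean space. -/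
def prodEquivEuclidean (n : ℕ) :
    ((Fin n → ℝ) × ℝ) ≃L[ℝ] EuclideanSpace ℝ (Fin n ⊕ Unit) :=
  LinearEquiv.toContinuousLinearEquiv
    { toFun := fun z => WithLp.toLp 2 (Sum.elim z.1 fun _ => z.2)
      invFun := fun x => (fun i => x (Sum.inl i), x (Sum.inr ()))
      map_add' := fun x y => by ext (i | i) <;> simp
      map_smul' := fun c x => by ext (i | i) <;> simp
      left_inv := fun z => by simp
      right_inv := fun x => by ext (i | i) <;> simp }

theorem prodEquivEuclidean_symm_apply (n : ℕ) (x : EuclideanSpace ℝ (Fin n ⊕ Unit)) :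
    (prodEquivEuclidean n).symm x = (fun i => x (Sum.inl i), x (Sum.inr ())) :=
  rfl

theorem eqOn_zero_of_dirac_of_eqOn_snd_eq_zero {n : ℕ} {a a' : Fin n → A} {b b' : A}
    (h : FactorsLaplacian (Sum.elim a fun _ : Unit => b) (Sum.elim a' fun _ => b'))
    {D : Set ((Fin n → ℝ) × ℝ)} (hD : IsOpen D) (hDc : IsPreconnected D)
    {u : (Fin n → ℝ) × ℝ → A} (hu : ContDiffOn ℝ 1 u D)
    (hsol : ∀ z ∈ D, ∑ i, a i * fderiv ℝ u z (Pi.single i 1, 0) + b * fderiv ℝ u z (0, 1) = 0)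
    {z₀ : (Fin n → ℝ) × ℝ} (hz₀ : z₀ ∈ D) (hz₀0 : z₀.2 = 0)
    (h0 : ∀ z ∈ D, z.2 = 0 → u z = 0) : Set.EqOn u 0 D := by
  set L := prodEquivEuclidean n with hL
  have hpre : IsPreconnected (L.symm ⁻¹' D) := by
    have : L.symm ⁻¹' D = L '' D := (L.image_eq_preimage_symm D).symm
    rw [this]
    exact hDc.image L L.continuous.continuousOn
  have hpo : IsOpen (L.symm ⁻¹' D) := hD.preimage L.symm.continuous
  have hDirac : IsDiracSol (Sum.elim a fun _ : Unit => b) (L.symm ⁻¹' D) (u ∘ L.symm) := by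
    refine ⟨hu.comp L.symm.contDiff.contDiffOn fun z hz => hz, fun z hz => ?_⟩
    have hd := (hu.contDiffAt (hD.mem_nhds hz)).differentiableAt one_ne_zero
    rw [dirac, (hd.hasFDerivAt.comp z L.symm.hasFDerivAt).fderiv, Fintype.sum_sum_type,
      ← hsol _ hz]
    have hinl : ∀ i, L.symm (EuclideanSpace.single (Sum.inl i) 1) = (Pi.single i 1, 0) :=
      fun i => by
        rw [hL, prodEquivEuclidean_symm_apply]
        ext j <;> simp [Pi.single_apply]
    have hinr : L.symm (EuclideanSpace.single (Sum.inr ()) 1) = (0, 1) := by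
      rw [hL, prodEquivEuclidean_symm_apply]
      ext j <;> simp
    simp [hinl, hinr]
  intro z hz
  have := hDirac.eqOn_zero_of_eqOn_hyperplane_of_incomplete h hpo hpre (i₀ := Sum.inr ())
    (z₀ := L z₀) (by simpa using hz₀) hz₀0 (fun x hx hx0 => h0 _ hx hx0)
    (show L z ∈ L.symm ⁻¹' D by simpa using hz)
  simpa using this

end Transfer

section Clifford

variable {p q : ℕ} {A : Type*} [NormedRing A] [NormedAlgebra ℝ A] (ξ : A ≃ₐ[ℝ] Cl (p + q))

theorem symm_ι_mul_add_swap (x y : Fin (p + q) → ℝ) :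
    ξ.symm (CliffordAlgebra.ι (Qe (p + q)) x) * ξ.symm (CliffordAlgebra.ι (Qe (p + q)) y)
      + ξ.symm (CliffordAlgebra.ι (Qe (p + q)) y) * ξ.symm (CliffordAlgebra.ι (Qe (p + q)) x)
      = algebraMap ℝ A (-2 * ∑ k, x k * y k) := by
  rw [← map_mul ξ.symm, ← map_mul ξ.symm, ← map_add ξ.symm, CliffordAlgebra.ι_mul_ι_add_swap, AlgEquiv.commutes]
  congr 1
  simp only [QuadraticMap.polar, Qe, QuadraticMap.weightedSumSquares_apply, Pi.add_apply,
    Finset.mul_sum, ← Finset.sum_sub_distrib, smul_eq_mul]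
  exact Finset.sum_congr rfl fun k _ => by ring

theorem eP_eq (i : Fin p) : eP p q ξ i
    = ξ.symm (CliffordAlgebra.ι (Qe (p + q)) (Fin.append (Pi.single i 1) 0)) := by
  have : (Fin.append (Pi.single i 1) 0 : Fin (p + q) → ℝ) = Pi.single (Fin.castAdd q i) 1 := by
    ext k
    refine Fin.addCases (fun k => ?_) (fun k => ?_) k
    · simp [Pi.single_apply]
    · simp [Pi.single_apply, Fin.ext_iff]
      omega
  rw [this]
  rfl

theorem ωCl_eq (v : Vq q) : ωCl p q ξ v
    = ξ.symm (CliffordAlgebra.ι (Qe (p + q)) (Fin.append 0 v)) := by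
  have : (Fin.append 0 v : Fin (p + q) → ℝ) = ∑ j, v j • Pi.single (Fin.natAdd p j) 1 := by
    conv_lhs => rw [← Finset.univ_sum_single (Fin.append 0 v : Fin (p + q) → ℝ)]
    rw [Fin.sum_univ_add]
    simp [← Pi.single_smul]
  rw [this]
  simp only [map_sum, map_smul]
  rfl

theorem eP_mul_add_swap (i j : Fin p) :
    eP p q ξ i * eP p q ξ j + eP p q ξ j * eP p q ξ i = if i = j then -2 else 0 := by
  rw [eP_eq, eP_eq, symm_ι_mul_add_swap, Fin.sum_univ_add]
  split_ifs with h
  · simp [h, Pi.single_apply, map_ofNat]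
  · simp [Pi.single_apply, h, eq_comm]

theorem eP_mul_ωCl (i : Fin p) (v : Vq q) :
    eP p q ξ i * ωCl p q ξ v = -(ωCl p q ξ v * eP p q ξ i) := by
  rw [eq_neg_iff_add_eq_zero, eP_eq, ωCl_eq, symm_ι_mul_add_swap, Fin.sum_univ_add]
  simp

theorem ωCl_mul_self {v : Vq q} (hv : v ∈ S q) : ωCl p q ξ v * ωCl p q ξ v = -1 := by
  have h := symm_ι_mul_add_swap ξ (Fin.append 0 v) (Fin.append 0 v)
  rw [← ωCl_eq, Fin.sum_univ_add] at h
  have hs : ∑ j, v j * v j = 1 := (Finset.sum_congr rfl fun j _ => (sq _).symm).trans hv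
  simp only [Fin.append_left, Fin.append_right, Pi.zero_apply, mul_zero, Finset.sum_const_zero,
    zero_add, hs, mul_one, map_neg, ← two_smul ℝ, map_ofNat] at h
  have h2 : (2 : ℝ) • (ωCl p q ξ v * ωCl p q ξ v) = (2 : ℝ) • (-1 : A) := by
    rw [h, two_smul, ← one_add_one_eq_two]
    abel
  exact smul_right_injective A two_ne_zero h2

theorem εp_zero : εp p q ξ 0 = 1 := by simp [εp]

theorem εp_succ (i : Fin p) : εp p q ξ i.succ = eP p q ξ i := by
  simp [εp, eP]

theorem factorsLaplacian_slice {v : Vq q} (hv : v ∈ S q) :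
    FactorsLaplacian (Sum.elim (εp p q ξ) fun _ : Unit => ωCl p q ξ v)
      (Sum.elim (Fin.cons 1 fun i => -eP p q ξ i) fun _ => -ωCl p q ξ v) := by
  have hω := ωCl_mul_self ξ hv
  have he : ∀ i j : Fin p, -(eP p q ξ i * eP p q ξ j) + -(eP p q ξ j * eP p q ξ i)
      = if i = j then 2 else 0 := fun i j => by
    rw [← neg_add, eP_mul_add_swap]
    split_ifs <;> simp
  rintro (i | i) (j | j)
  · refine Fin.cases ?_ (fun i => ?_) i <;> refine Fin.cases ?_ (fun j => ?_) j
    · simp [εp_zero, one_add_one_eq_two]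
    · simp [εp_zero, εp_succ, (Fin.succ_ne_zero j).symm]
    · simp [εp_zero, εp_succ]
    · simpa [εp_succ] using he i j
  · refine Fin.cases ?_ (fun i => ?_) i
    · simp [εp_zero]
    · simp [εp_succ, eP_mul_ωCl]
  · refine Fin.cases ?_ (fun j => ?_) j
    · simp [εp_zero]
    · simp [εp_succ, eP_mul_ωCl]
  · simp [hω, one_add_one_eq_two]

end Clifford

section SliceSystem

variable {p q : ℕ} {A : Type*} [NormedRing A] [NormedAlgebra ℝ A] (ξ : A ≃ₐ[ℝ] Cl (p + q))

theorem sum_εp_mul_ωCl_mul (v : Vq q) (ℓ : Fin (p + 1) → A) :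
    ∑ i, εp p q ξ i * (ωCl p q ξ v * ℓ i)
      = ωCl p q ξ v * (ℓ 0 - ∑ i : Fin p, eP p q ξ i * ℓ i.succ) := by
  rw [Fin.sum_univ_succ, mul_sub, Finset.mul_sum, sub_eq_add_neg, ← Finset.sum_neg_distrib]
  simp only [εp_zero, εp_succ, one_mul, ← mul_assoc, eP_mul_ωCl, neg_mul]

theorem ωCl_mul_sub_sum_eP (v : Vq q) (ℓ : Fin (p + 1) → A) :
    ωCl p q ξ v * ℓ 0 - ∑ i : Fin p, eP p q ξ i * (ωCl p q ξ v * ℓ i.succ)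
      = ωCl p q ξ v * ∑ i, εp p q ξ i * ℓ i := by
  rw [Fin.sum_univ_succ, mul_add, Finset.mul_sum, sub_eq_add_neg, ← Finset.sum_neg_distrib]
  simp only [εp_zero, εp_succ, one_mul, ← mul_assoc, eP_mul_ωCl, neg_mul, neg_neg]

theorem ωCl_mul_ωCl_mul {v : Vq q} (hv : v ∈ S q) (x : A) :
    ωCl p q ξ v * (ωCl p q ξ v * x) = -x := by
  rw [← mul_assoc, ωCl_mul_self ξ hv, neg_one_mul]

theorem DP_add_ωCl_mul_pdr {v : Vq q} (hv : v ∈ S q) {F1 F2 : Sl p → A} {z : Sl p}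
    (h1 : DifferentiableAt ℝ F1 z) (h2 : DifferentiableAt ℝ F2 z) :
    DP p q ξ (fun z => F1 z + ωCl p q ξ v * F2 z) z
        + ωCl p q ξ v * pdr p (fun z => F1 z + ωCl p q ξ v * F2 z) z
      = (DP p q ξ F1 z - pdr p F2 z) + ωCl p q ξ v * (DPbar p q ξ F2 z + pdr p F1 z) := by
  have h := (h1.hasFDerivAt.fun_add (h2.hasFDerivAt.const_mul (ωCl p q ξ v))).fderiv
  simp only [DP, pdSl, pdr, DPbar, h, add_apply, smul_apply,
    smul_eq_mul, mul_add, Finset.sum_add_distrib, ωCl_mul_ωCl_mul ξ hv,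
    sum_εp_mul_ωCl_mul ξ v fun i => fderiv ℝ F2 z (Pi.single i 1, 0)]
  abel

/-- The reflection of the last variable. -/
def reflect (p : ℕ) : Sl p →L[ℝ] Sl p :=
  (ContinuousLinearMap.fst ℝ (Vp p) ℝ).prod (-ContinuousLinearMap.snd ℝ (Vp p) ℝ)

theorem reflect_apply (z : Sl p) : reflect p z = (z.1, -z.2) := rfl

theorem reflect_reflect (z : Sl p) : reflect p (reflect p z) = z := by simp [reflect_apply]

/-- The even component of the slice function determined by its values on one slice. -/
def evenPart (g : Sl p → A) (z : Sl p) : A := (1 / 2 : ℝ) • (g z + g (reflect p z))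

/-- The odd component of the slice function determined by its values on the slice of `v`. -/
def oddPart (v : Vq q) (g : Sl p → A) (z : Sl p) : A :=
  -((1 / 2 : ℝ) • (ωCl p q ξ v * (g z - g (reflect p z))))

theorem evenPart_reflect (g : Sl p → A) (z : Sl p) :
    evenPart g (reflect p z) = evenPart g z := by
  rw [evenPart, evenPart, reflect_reflect, add_comm]

theorem oddPart_reflect (v : Vq q) (g : Sl p → A) (z : Sl p) :
    oddPart ξ v g (reflect p z) = -oddPart ξ v g z := by
  rw [oddPart, oddPart, reflect_reflect, ← neg_sub (g z), mul_neg, smul_neg]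

variable {D : Set (Sl p)}

theorem contDiffOn_evenPart (hrefl : ReflInv p D) {g : Sl p → A} (hg : ContDiffOn ℝ 1 g D) :
    ContDiffOn ℝ 1 (evenPart g) D :=
  (hg.add (hg.comp (reflect p).contDiff.contDiffOn hrefl)).const_smul _

theorem contDiffOn_oddPart (hrefl : ReflInv p D) (v : Vq q) {g : Sl p → A}
    (hg : ContDiffOn ℝ 1 g D) : ContDiffOn ℝ 1 (oddPart ξ v g) D :=
  ((contDiffOn_const.mul
    (hg.sub (hg.comp (reflect p).contDiff.contDiffOn hrefl))).const_smul _).neg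

theorem crSystem_evenPart_oddPart (hD : IsOpen D) (hrefl : ReflInv p D) {v : Vq q} (hv : v ∈ S q)
    {g : Sl p → A} (hg : ContDiffOn ℝ 1 g D)
    (hsol : ∀ z ∈ D, DP p q ξ g z + ωCl p q ξ v * pdr p g z = 0) :
    CRSystem p q ξ D (evenPart g) (oddPart ξ v g) := by
  intro z hz
  have hd : ∀ z ∈ D, HasFDerivAt g (fderiv ℝ g z) z := fun z hz =>
    ((hg.contDiffAt (hD.mem_nhds hz)).differentiableAt one_ne_zero).hasFDerivAt
  have hr : HasFDerivAt (fun z => g (reflect p z)) ((fderiv ℝ g (reflect p z)).comp (reflect p)) z :=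
    (hd _ (hrefl z hz)).comp z (reflect p).hasFDerivAt
  have he := (((hd z hz).fun_add hr).const_smul (1 / 2 : ℝ)).fderiv
  have ho := ((((hd z hz).fun_sub hr).const_mul (ωCl p q ξ v)).const_smul (1 / 2 : ℝ)).neg.fderiv
  change fderiv ℝ (evenPart g) z = _ at he
  change fderiv ℝ (oddPart ξ v g) z = _ at ho
  have h1 := hsol z hz
  have h2 := hsol _ (hrefl z hz)
  rw [← reflect_apply] at h2
  simp only [DP, pdSl, pdr, ← eq_neg_iff_add_eq_zero] at h1 h2
  set L := fderiv ℝ g z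
  set L' := fderiv ℝ g (reflect p z)
  have hx : ∀ x : Vp p, reflect p (x, 0) = (x, 0) := fun x => by simp [reflect_apply]
  have hy : L' (reflect p (0, 1)) = -L' (0, 1) := by
    rw [← map_neg]
    simp [reflect_apply]
  have hDbar := ωCl_mul_sub_sum_eP ξ v fun i =>
    L (Pi.single i 1, 0) - L' (Pi.single i 1, 0)
  simp only [mul_sub (εp p q ξ _), Finset.sum_sub_distrib, h1, h2] at hDbar
  constructor
  · simp only [DP, pdSl, pdr, he, ho, add_apply, smul_apply, neg_apply, sub_apply,
      ContinuousLinearMap.comp_apply, hx, hy, smul_eq_mul, mul_smul_comm, mul_add,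
      Finset.sum_add_distrib, ← Finset.smul_sum, h1, h2, sub_neg_eq_add, ← smul_add]
    refine smul_eq_zero_of_right _ ?_
    abel
  · simp only [DPbar, pdSl, pdr, he, ho, add_apply, smul_apply, neg_apply, sub_apply,
      ContinuousLinearMap.comp_apply, hx, hy, smul_eq_mul, mul_smul_comm, mul_neg,
      ← Finset.smul_sum, Finset.sum_neg_distrib, sub_neg_eq_add]
    rw [neg_add_eq_sub, ← neg_sub, ← smul_sub, hDbar, ← smul_neg, ← smul_add]
    refine smul_eq_zero_of_right _ ?_
    simp only [mul_sub, mul_neg, ωCl_mul_ωCl_mul ξ hv]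
    abel

end SliceSystem

section Completion

variable {p q : ℕ}

theorem norm_eq_one_of_mem_S {v : Vq q} (hv : v ∈ S q) : ‖v‖ = 1 := by
  have h : ‖v‖ ^ 2 = 1 := (EuclideanSpace.real_norm_sq_eq v).trans hv
  nlinarith [norm_nonneg v]

theorem sliceSet_completion {D : Set (Sl p)} (hrefl : ReflInv p D) {v : Vq q} (hv : v ∈ S q) :
    sliceSet p q (completion p q D) v = D := by
  refine Set.Subset.antisymm ?_ fun z hz => ⟨z, hz, v, hv, rfl⟩
  rintro ⟨x, r⟩ ⟨⟨y, s⟩, hz, w, hw, h⟩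
  obtain ⟨h1, h2⟩ := Prod.mk.injEq _ _ _ _ ▸ h
  dsimp only at h1 h2
  have hn := congrArg norm h2
  rw [norm_smul, norm_smul, norm_eq_one_of_mem_S hv, norm_eq_one_of_mem_S hw, mul_one, mul_one,
    Real.norm_eq_abs, Real.norm_eq_abs, abs_eq_abs] at hn
  subst h1
  rcases hn with rfl | rfl
  · exact hz
  · exact hrefl _ hz

theorem exists_mem_snd_eq_zero {D : Set (Sl p)} (hD : IsConnected D) (hrefl : ReflInv p D) :
    ∃ z ∈ D, z.2 = 0 := by
  obtain ⟨z, hz⟩ := hD.nonempty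
  have hi : (Prod.snd '' D).OrdConnected :=
    (hD.isPreconnected.image _ continuous_snd.continuousOn).ordConnected
  have h1 : z.2 ∈ Prod.snd '' D := ⟨z, hz, rfl⟩
  have h2 : -z.2 ∈ Prod.snd '' D := ⟨_, hrefl z hz, rfl⟩
  rcases le_total 0 z.2 with h | h
  · exact hi.out h2 h1 ⟨by linarith, h⟩
  · exact hi.out h1 h2 ⟨h, by linarith⟩

variable {A : Type*} [NormedRing A] [NormedAlgebra ℝ A] (ξ : A ≃ₐ[ℝ] Cl (p + q))

theorem DP_pdr_congr {D : Set (Sl p)} (hD : IsOpen D) {F G : Sl p → A} (h : Set.EqOn F G D)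
    {z : Sl p} (hz : z ∈ D) : DP p q ξ F z = DP p q ξ G z ∧ pdr p F z = pdr p G z := by
  have := (h.eventuallyEq_of_mem (hD.mem_nhds hz)).fderiv_eq (𝕜 := ℝ)
  simp only [DP, pdSl, pdr, this, and_self]

/-- Generalized partial-slice regular functions are generalized partial-slice monogenic. -/
theorem gsmOn_of_gsrOn {D : Set (Sl p)} (hD : IsOpen D) (hrefl : ReflInv p D) {f : V p q → A}
    (hf : GSROn p q ξ D f) : GSMOn p q ξ (completion p q D) f := by
  obtain ⟨F1, F2, ⟨-, hfF⟩, h1, h2, hCR⟩ := hf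
  intro v hv
  rw [sliceSet_completion hrefl hv]
  have heq : Set.EqOn (fun z => f (spt p q v z)) (fun z => F1 z + ωCl p q ξ v * F2 z) D :=
    fun z hz => hfF z hz v hv
  refine ⟨(h1.add (contDiffOn_const.mul h2)).congr heq, fun z hz => ?_⟩
  rw [(DP_pdr_congr ξ hD heq hz).1, (DP_pdr_congr ξ hD heq hz).2, DP_add_ωCl_mul_pdr ξ hv
    ((h1.contDiffAt (hD.mem_nhds hz)).differentiableAt one_ne_zero)
    ((h2.contDiffAt (hD.mem_nhds hz)).differentiableAt one_ne_zero), (hCR z hz).1, (hCR z hz).2,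
    mul_zero, add_zero]

/-- On the completion of a symmetric domain, generalized partial-slice monogenic functions are
determined by their values on one slice, hence are generalized partial-slice regular. -/
theorem gsrOn_of_gsmOn {D : Set (Sl p)} (hD : IsOpen D) (hDc : IsConnected D)
    (hrefl : ReflInv p D) {v : Vq q} (hv : v ∈ S q) {f : V p q → A}
    (hf : GSMOn p q ξ (completion p q D) f) : GSROn p q ξ D f := by
  have hslice : ∀ w ∈ S q, ContDiffOn ℝ 1 (fun z => f (spt p q w z)) D ∧ ∀ z ∈ D,
      DP p q ξ (fun z => f (spt p q w z)) z
        + ωCl p q ξ w * pdr p (fun z => f (spt p q w z)) z = 0 := fun w hw => by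
    simpa only [sliceSet_completion hrefl hw] using hf w hw
  obtain ⟨z₀, hz₀, hz₀0⟩ := exists_mem_snd_eq_zero hDc hrefl
  set g : Sl p → A := fun z => f (spt p q v z) with hg
  have hE := contDiffOn_evenPart hrefl (hslice v hv).1
  have hO := contDiffOn_oddPart ξ hrefl v (hslice v hv).1
  have hCR := crSystem_evenPart_oddPart ξ hD hrefl hv (hslice v hv).1 (hslice v hv).2
  refine ⟨evenPart g, oddPart ξ v g, ⟨fun z hz => ⟨evenPart_reflect g z, oddPart_reflect ξ v g z⟩,
    fun z hz w hw => ?_⟩, hE, hO, hCR⟩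
  have hG := hE.add (contDiffOn_const.mul hO : ContDiffOn ℝ 1 (fun z => ωCl p q ξ w *
    oddPart ξ v g z) D)
  have hdiff : ∀ {F : Sl p → A}, ContDiffOn ℝ 1 F D → ∀ z ∈ D, DifferentiableAt ℝ F z :=
    fun hF z hz => (hF.contDiffAt (hD.mem_nhds hz)).differentiableAt one_ne_zero
  have hzero := eqOn_zero_of_dirac_of_eqOn_snd_eq_zero (factorsLaplacian_slice ξ hw) hD
    hDc.isPreconnected ((hslice w hw).1.sub hG) (fun z hz => ?_) hz₀ hz₀0 (fun z hz hz0 => ?_) hz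
  · exact sub_eq_zero.1 hzero
  · have h1 := (hslice w hw).2 z hz
    have h2 := DP_add_ωCl_mul_pdr ξ hw (hdiff hE z hz) (hdiff hO z hz)
    rw [(hCR z hz).1, (hCR z hz).2, mul_zero, add_zero] at h2
    have h3 := ((hdiff (hslice w hw).1 z hz).hasFDerivAt.fun_sub (hdiff hG z hz).hasFDerivAt).fderiv
    rw [h3]
    simp only [sub_apply, mul_sub, Finset.sum_sub_distrib]
    have h4 := congrArg₂ (· - ·) h1 h2
    simp only [sub_zero] at h4
    rw [sub_add_sub_comm]
    exact h4
  · have hr : reflect p z = z := by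
      rw [reflect_apply, hz0, neg_zero, ← hz0]
    have hs : ∀ w, spt p q w z = (z.1, 0) := fun w => by rw [spt, hz0, zero_smul]
    have he : evenPart g z = g z := by
      rw [evenPart, hr, ← two_smul ℝ, smul_smul]
      norm_num
    have ho : oddPart ξ v g z = 0 := by simp [oddPart, hr]
    change f (spt p q w z) - (evenPart g z + ωCl p q ξ w * oddPart ξ v g z) = 0
    rw [he, ho]
    simp [hg, hs]

end Completion

end CliffordDirac

/-- Theorem 2.11.  Let `D ⊆ ℝ^{p+2}` be a domain invariant under the reflection of the
`(p+2)`-th variable, and `Ω = Ω_D` its p-symmetric completion.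
(i) If `Ω ∩ ℝ^{p+1} = ∅` then `𝒢𝒮ℛ(Ω_D) ⊊ 𝒢𝒮ℳ(Ω)`.
(ii) If `Ω ∩ ℝ^{p+1} ≠ ∅` then `𝒢𝒮ℳ(Ω) = 𝒢𝒮ℛ(Ω_D)`. -/
theorem gsr_versus_gsm
    (p q : ℕ) (hq : 1 ≤ q) {A : Type*} [NormedRing A] [NormedAlgebra ℝ A]
    (ξ : A ≃ₐ[ℝ] Cl (p + q))
    (D : Set (Sl p)) (hD : IsDomain D) (hrefl : ReflInv p D) :
    ((¬ ∃ x : Vp p, ((x, 0) : V p q) ∈ completion p q D) →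
      (∀ f : V p q → A, GSROn p q ξ D f → GSMOn p q ξ (completion p q D) f) ∧
      ∃ f : V p q → A, GSMOn p q ξ (completion p q D) f ∧ ¬ GSROn p q ξ D f) ∧
    ((∃ x : Vp p, ((x, 0) : V p q) ∈ completion p q D) →
      ∀ f : V p q → A, GSMOn p q ξ (completion p q D) f ↔ GSROn p q ξ D f) := by
  obtain ⟨z₀, hz₀, hz₀0⟩ := CliffordDirac.exists_mem_snd_eq_zero hD.2 hrefl
  have hv : (EuclideanSpace.single ⟨0, hq⟩ 1 : Vq q) ∈ S q := by
    simp [S]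
  refine ⟨fun hempty => (hempty ⟨z₀.1, z₀, hz₀, _, hv, ?_⟩).elim, fun _ f =>
    ⟨CliffordDirac.gsrOn_of_gsmOn ξ hD.1 hD.2 hrefl hv, CliffordDirac.gsmOn_of_gsrOn ξ hD.1 hrefl⟩⟩
  rw [spt, hz₀0, zero_smul]
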